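/- arXiv:1103.5647 — 7 statements merged into one kernel-verified Lean document; each statement's English description precedes it below -/
import Mathlib

section
/- Let a ∈ (0,1) and λ > 0, and define ρ(u) = u^λ - u + a for u > 0. Then there exists u ∈ (0,1) with ρ(u) = 0 if and only if λ > 1 and λ^{λ/(1-λ)} - λ^{1/(1-λ)} + a ≤ 0. -/
open Real Set

/-- The point `l ^ (1 / (1 - l))` is where the derivative of `u ↦ u ^ l - u` vanishes; there the
convex function `u ↦ u ^ l - u` attains its minimum over the positive reals. -/
theorem rpow_sub_self_min_le {l u : ℝ} (hl : 1 < l) (hu : 0 < u) :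
    l ^ (l / (1 - l)) - l ^ (1 / (1 - l)) ≤ u ^ l - u := by
  have hl0 : 0 < l := by linarith
  have hne : 1 - l ≠ 0 := by linarith
  set c := l ^ (1 / (1 - l)) with hc
  have hc0 : 0 < c := Real.rpow_pos_of_pos hl0 _
  have hcl : l ^ (l / (1 - l)) = c ^ l := by
    rw [hc, ← Real.rpow_mul hl0.le, one_div_mul_eq_div]
  have hmul : c ^ l * l = c := by
    rw [← hcl, ← Real.rpow_add_one hl0.ne', hc]
    congr 1
    field_simp
    ring
  have bern : 1 + l * (u / c - 1) ≤ (1 + (u / c - 1)) ^ l :=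
    one_add_mul_self_le_rpow_one_add (by linarith [div_pos hu hc0]) hl.le
  rw [add_sub_cancel, Real.div_rpow hu.le hc0.le, le_div_iff₀ (Real.rpow_pos_of_pos hc0 _)] at bern
  have expand : (1 + l * (u / c - 1)) * c ^ l = c ^ l + (u - c) := by
    calc (1 + l * (u / c - 1)) * c ^ l = c ^ l + (c ^ l * l) * (u / c - 1) := by ring
      _ = c ^ l + (u - c) := by rw [hmul]; field_simp
  rw [hcl]
  linarith

/-- For the iris system with offset `a ∈ (0,1)` and saddle eigenvalue ratio `lam > 0`,
the function `ρ u = u^lam - u + a` has a root in `(0,1)` if and only if `lam > 1` and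
`lam^(lam/(1-lam)) - lam^(1/(1-lam)) + a ≤ 0`. -/
theorem stmt1 (a lam : ℝ) (ha : a ∈ Set.Ioo (0:ℝ) 1) (hlam : 0 < lam)
    (ρ : ℝ → ℝ) (hρ : ∀ u : ℝ, 0 < u → ρ u = u ^ lam - u + a) :
    (∃ u ∈ Set.Ioo (0:ℝ) 1, ρ u = 0) ↔
      (1 < lam ∧ lam ^ (lam / (1 - lam)) - lam ^ (1 / (1 - lam)) + a ≤ 0) := by
  obtain ⟨ha0, -⟩ := ha
  constructor
  · rintro ⟨u, ⟨hu0, hu1⟩, hu⟩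
    rw [hρ u hu0] at hu
    have hl : 1 < lam := by
      by_contra! h
      have := Real.rpow_le_rpow_of_exponent_ge hu0 hu1.le h
      rw [Real.rpow_one] at this
      linarith
    exact ⟨hl, by linarith [rpow_sub_self_min_le hl hu0]⟩
  · rintro ⟨hl, hle⟩
    set c := lam ^ (1 / (1 - lam)) with hc
    have hc0 : 0 < c := Real.rpow_pos_of_pos hlam _
    have hc1 : c < 1 :=
      Real.rpow_lt_one_of_one_lt_of_neg hl (one_div_neg.mpr (by linarith))
    have hcl : lam ^ (lam / (1 - lam)) = c ^ lam := by
      rw [hc, ← Real.rpow_mul hlam.le, one_div_mul_eq_div]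
    rw [hcl] at hle
    have hcont : ContinuousOn (fun u : ℝ => u ^ lam - u + a) (Set.Icc c 1) :=
      (((Real.continuous_rpow_const hlam.le).sub continuous_id).add
        continuous_const).continuousOn
    obtain ⟨u, ⟨hcu, hu1⟩, hu⟩ := intermediate_value_Ico hc1.le hcont
      (show (0 : ℝ) ∈ Set.Ico _ _ from ⟨hle, by simpa using ha0⟩)
    have hu0 : 0 < u := hc0.trans_le hcu
    exact ⟨u, ⟨hu0, hu1⟩, (hρ u hu0).trans hu⟩
end

section
/- Let λ > 1 and a ∈ (0,1), suppose u† and u‡ with 0 < u† < u‡ < 1 are the only roots in (0,1) of ρ(u) = u^λ - u + a, and let h(u) = u^λ + a. Then for every initial point u₀ ∈ [0, u‡), the sequence of iterates hⁿ(u₀) converges to u† as n → ∞. -/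
open Real Set Filter Topology

/-- A continuous self-map of `[p, q]` fixing `q`, with `x < f x` for `x ∈ [p, q)`, has all orbits
in `[p, q]` converging to `q`. -/
theorem tendsto_iterate_of_lt_map {f : ℝ → ℝ} (hf : Continuous f) {p q : ℝ}
    (hmaps : MapsTo f (Icc p q) (Icc p q)) (hq : f q = q) (hlt : ∀ x ∈ Ico p q, x < f x)
    {x : ℝ} (hx : x ∈ Icc p q) : Tendsto (fun n : ℕ => f^[n] x) atTop (𝓝 q) := by
  have hmem : ∀ n : ℕ, f^[n] x ∈ Icc p q := fun n => hmaps.iterate n hx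
  have hmono : Monotone fun n : ℕ => f^[n] x := by
    refine monotone_nat_of_le_succ fun n => ?_
    rw [Function.iterate_succ_apply']
    rcases (hmem n).2.lt_or_eq with hn | hn
    · exact (hlt _ ⟨(hmem n).1, hn⟩).le
    · rw [hn, hq]
  have hlim := tendsto_atTop_ciSup hmono ⟨q, forall_mem_range.2 fun n => (hmem n).2⟩
  have hL := isClosed_Icc.mem_of_tendsto hlim (Eventually.of_forall hmem)
  have hfix := isFixedPt_of_tendsto_iterate hlim hf.continuousAt
  rcases hL.2.lt_or_eq with hn | hn
  · exact absurd hfix (hlt _ ⟨hL.1, hn⟩).ne'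
  · rwa [hn] at hlim

/-- A continuous self-map of `[p, q]` fixing `p`, with `f x < x` for `x ∈ (p, q]`, has all orbits
in `[p, q]` converging to `p`. -/
theorem tendsto_iterate_of_map_lt {f : ℝ → ℝ} (hf : Continuous f) {p q : ℝ}
    (hmaps : MapsTo f (Icc p q) (Icc p q)) (hp : f p = p) (hlt : ∀ x ∈ Ioc p q, f x < x)
    {x : ℝ} (hx : x ∈ Icc p q) : Tendsto (fun n : ℕ => f^[n] x) atTop (𝓝 p) := by
  have hmem : ∀ n : ℕ, f^[n] x ∈ Icc p q := fun n => hmaps.iterate n hx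
  have hanti : Antitone fun n : ℕ => f^[n] x := by
    refine antitone_nat_of_succ_le fun n => ?_
    rw [Function.iterate_succ_apply']
    rcases (hmem n).1.lt_or_eq with hn | hn
    · exact (hlt _ ⟨hn, (hmem n).2⟩).le
    · rw [← hn, hp]
  have hlim := tendsto_atTop_ciInf hanti ⟨p, forall_mem_range.2 fun n => (hmem n).1⟩
  have hL := isClosed_Icc.mem_of_tendsto hlim (Eventually.of_forall hmem)
  have hfix := isFixedPt_of_tendsto_iterate hlim hf.continuousAt
  rcases hL.1.lt_or_eq with hn | hn
  · exact absurd hfix (hlt _ ⟨hn, hL.2⟩).ne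
  · rwa [← hn] at hlim

/-- For `lam > 1`, `a ∈ (0,1)`, if `u† < u‡` are the only roots in `(0,1)` of
`ρ u = u^lam - u + a`, then every iterate sequence of `h u = u^lam + a` started at
`u₀ ∈ [0, u‡)` converges to `u†`. -/
theorem stmt4 (lam a udag uddag : ℝ) (hlam : 1 < lam) (ha : a ∈ Set.Ioo (0:ℝ) 1)
    (h : ℝ → ℝ) (hh : h = fun u => u ^ lam + a)
    (h0 : 0 < udag) (h1 : udag < uddag) (h2 : uddag < 1)
    (hroot1 : udag ^ lam - udag + a = 0)
    (hroot2 : uddag ^ lam - uddag + a = 0)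
    (honly : ∀ v ∈ Set.Ioo (0:ℝ) 1, v ^ lam - v + a = 0 → v = udag ∨ v = uddag) :
    ∀ u₀ ∈ Set.Ico (0:ℝ) uddag,
      Filter.Tendsto (fun n : ℕ => h^[n] u₀) Filter.atTop (nhds udag) := by
  intro u₀ hu₀
  have hcont : Continuous h := by
    rw [hh]
    exact (Real.continuous_rpow_const (by linarith)).add continuous_const
  have happ : ∀ u, h u = u ^ lam + a := fun u => by rw [hh]
  have hfix : h udag = udag := by rw [happ]; linarith
  have hmono : ∀ {x y : ℝ}, 0 ≤ x → x ≤ y → h x ≤ h y := fun {x y} hx hxy => by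
    rw [happ, happ]
    gcongr
  have hconv := strictConvexOn_rpow hlam
  rcases le_total u₀ udag with hle | hle
  · have hlt : ∀ x ∈ Ico 0 udag, x < h x := fun x hx => by
      have hs := hconv.slope_strict_mono_adjacent (mem_Ici.2 hx.1)
        (mem_Ici.2 (h0.trans h1).le) hx.2 h1
      rw [show uddag ^ lam - udag ^ lam = uddag - udag by linarith,
        div_self (sub_pos.2 h1).ne', div_lt_one (sub_pos.2 hx.2)] at hs
      rw [happ]
      linarith
    refine tendsto_iterate_of_lt_map hcont (p := 0) (fun x hx => ⟨?_, ?_⟩) hfix hlt ⟨hu₀.1, hle⟩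
    · rw [happ]
      exact add_nonneg (Real.rpow_nonneg hx.1 _) ha.1.le
    · exact (hmono hx.1 hx.2).trans_eq hfix
  · have hlt : ∀ x ∈ Ioc udag u₀, h x < x := fun x hx => by
      have hs := hconv.slope_strict_mono_adjacent (mem_Ici.2 h0.le)
        (mem_Ici.2 (h0.trans h1).le) hx.1 (hx.2.trans_lt hu₀.2)
      rw [div_lt_div_iff₀ (sub_pos.2 hx.1) (sub_pos.2 (hx.2.trans_lt hu₀.2))] at hs
      rw [show udag ^ lam = udag - a by linarith, show uddag ^ lam = uddag - a by linarith] at hs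
      rw [happ]
      by_contra! hge
      nlinarith [mul_nonneg (sub_nonneg.2 hge) (sub_pos.2 h1).le]
    refine tendsto_iterate_of_map_lt hcont (q := u₀) (fun x hx => ⟨?_, ?_⟩) hfix hlt ⟨hle, le_rfl⟩
    · exact hfix.symm.trans_le (hmono h0.le hx.1)
    · rcases hx.1.lt_or_eq with hn | hn
      · exact (hlt x ⟨hn, hx.2⟩).le.trans hx.2
      · rw [← hn, hfix]
        exact hle
end

section
/- Let λ > 0 and u₀ > 0. The function q(t) = λ² e^{-2λt} + u₀² e^{2t}, giving the squared speed of the trajectory (s(t), u(t)) = (e^{-λt}, u₀ e^{t}), attains its unique global minimum over t ∈ ℝ at t_slowest = (3 log λ - 2 log u₀) / (2(λ+1)), and at this time u(t_slowest) = λ^{3/2} · s(t_slowest); i.e., the slowest point of the trajectory lies on the line u = λ^{3/2} s through the saddle. -/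
open Real

/-- For `lam > 0` and `u₀ > 0`, the squared speed `q t = lam² exp(-2 lam t) + u₀² exp(2t)`
of the trajectory `(exp(-lam t), u₀ exp t)` attains its unique global minimum at
`t_slowest = (3 log lam - 2 log u₀)/(2(lam+1))`, and at that time
`u(t_slowest) = lam^(3/2) · s(t_slowest)`. -/
theorem stmt6 (lam u₀ : ℝ) (hlam : 0 < lam) (hu₀ : 0 < u₀)
    (q : ℝ → ℝ)
    (hq : q = fun t => lam ^ 2 * Real.exp (-2 * lam * t) + u₀ ^ 2 * Real.exp (2 * t))
    (ts : ℝ) (hts : ts = (3 * Real.log lam - 2 * Real.log u₀) / (2 * (lam + 1))) :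
    (∀ t : ℝ, t ≠ ts → q ts < q t) ∧
    u₀ * Real.exp ts = lam ^ ((3:ℝ)/2) * Real.exp (-lam * ts) := by
  have line : u₀ * exp ts = lam ^ ((3:ℝ)/2) * exp (-lam * ts) := by
    rw [rpow_def_of_pos hlam, ← exp_add]
    nth_rw 1 [← exp_log hu₀]
    rw [← exp_add, exp_eq_exp, hts]
    field_simp
    ring
  refine ⟨fun t ht => ?_, line⟩
  have hd : t - ts ≠ 0 := sub_ne_zero.mpr ht
  set A := lam ^ 2 * exp (-2 * lam * ts) with hA
  have hApos : 0 < A := by positivity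
  have hB : u₀ ^ 2 * exp (2 * ts) = lam * A := by
    have hcube : (lam ^ ((3:ℝ)/2)) ^ 2 = lam ^ 3 := by
      rw [← rpow_natCast, ← rpow_mul hlam.le, ← rpow_natCast]
      norm_num
    calc u₀ ^ 2 * exp (2 * ts) = (u₀ * exp ts) ^ 2 := by
          rw [mul_pow, ← exp_nat_mul]; norm_num
      _ = lam ^ 3 * exp (-2 * lam * ts) := by
          rw [line, mul_pow, hcube, ← exp_nat_mul]
          congr 2
          push_cast
          ring
      _ = lam * A := by rw [hA]; ring
  have hs : lam ^ 2 * exp (-2 * lam * t) = A * exp (-2 * lam * (t - ts)) := by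
    rw [hA, mul_assoc (lam ^ 2), ← exp_add]
    ring_nf
  have hu : u₀ ^ 2 * exp (2 * t) = lam * A * exp (2 * (t - ts)) := by
    rw [← hB, mul_assoc, ← exp_add]
    ring_nf
  have h₁ : -2 * lam * (t - ts) + 1 < exp (-2 * lam * (t - ts)) :=
    add_one_lt_exp (mul_ne_zero (by linarith) hd)
  have h₂ : 2 * (t - ts) + 1 < exp (2 * (t - ts)) :=
    add_one_lt_exp (mul_ne_zero two_ne_zero hd)
  have hq_ts : q ts = A + lam * A := by simp only [hq, hB, hA]
  have hq_t : q t = A * exp (-2 * lam * (t - ts)) + lam * A * exp (2 * (t - ts)) := by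
    simp only [hq, hs, hu]
  rw [hq_ts, hq_t]
  calc A + lam * A
      = A * (-2 * lam * (t - ts) + 1) + lam * A * (2 * (t - ts) + 1) := by ring
    _ < A * exp (-2 * lam * (t - ts)) + lam * A * exp (2 * (t - ts)) := by gcongr
end

section
/- Let λ > 1. There exists δ > 0 such that for every a ∈ (0, δ) the function ρ(u) = u^λ - u + a has a smallest root u†(a) in (0,1); this root satisfies u†(a) > a, and lim_{a → 0⁺} u†(a)/a = 1, i.e., u†(a) = a + o(a) as a → 0⁺. -/
open Real Set Filter Topology

/-- If `(2a)^(lam-1) ≤ 1/2`, then `u^lam - u + a` has a smallest nonnegative root,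
and this root is at most `2a`. -/
theorem exists_isLeast_root {lam a : ℝ} (hlam : 1 < lam) (ha : 0 < a)
    (h : (2 * a) ^ (lam - 1) ≤ 1 / 2) :
    ∃ u ≤ 2 * a, IsLeast {v : ℝ | 0 ≤ v ∧ v ^ lam - v + a = 0} u := by
  have hcont : Continuous fun v : ℝ => v ^ lam - v + a :=
    ((continuous_id.rpow_const fun _ => Or.inr (by linarith)).sub continuous_id).add
      continuous_const
  have hend : (2 * a) ^ lam - 2 * a + a ≤ 0 := by
    have : (2 * a) ^ lam = (2 * a) ^ (lam - 1) * (2 * a) := by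
      rw [← rpow_add_one (by positivity), sub_add_cancel]
    nlinarith
  have hzero : 0 ≤ (0 : ℝ) ^ lam - 0 + a := by
    rw [zero_rpow (by linarith)]
    linarith
  obtain ⟨w, hw, hw0⟩ := intermediate_value_Icc' (by positivity : (0 : ℝ) ≤ 2 * a)
    hcont.continuousOn ⟨hend, hzero⟩
  have hcompact : IsCompact (Icc 0 (2 * a) ∩ {v : ℝ | v ^ lam - v + a = 0}) :=
    isCompact_Icc.inter_right (isClosed_eq hcont continuous_const)
  obtain ⟨u, ⟨hu, hu0⟩, hmin⟩ := hcompact.exists_isLeast ⟨w, hw, hw0⟩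
  refine ⟨u, hu.2, ⟨hu.1, hu0⟩, fun v hv => ?_⟩
  rcases le_total v (2 * a) with hva | hva
  · exact hmin ⟨⟨hv.1, hva⟩, hv.2⟩
  · exact hu.2.trans hva

/-- A positive root `u ≤ 2a` of `u^lam - u + a` satisfies `u / a ≤ 1 + 2 (2a)^(lam-1)`. -/
theorem root_div_le {lam a u : ℝ} (hlam : 1 < lam) (ha : 0 < a) (hu : 0 < u)
    (hu2 : u ≤ 2 * a) (hroot : u ^ lam - u + a = 0) :
    u / a ≤ 1 + 2 * (2 * a) ^ (lam - 1) := by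
  have hpow : u ^ lam = u ^ (lam - 1) * u := by
    rw [← rpow_add_one hu.ne', sub_add_cancel]
  have hle : u ^ (lam - 1) * u ≤ (2 * a) ^ (lam - 1) * (2 * a) := by
    gcongr
  rw [div_le_iff₀ ha]
  linarith

/-- For `lam > 1`, for all sufficiently small `a > 0` the function
`ρ u = u^lam - u + a` has a smallest positive root `U a ∈ (0,1)`, which exceeds `a`,
and `U a / a → 1` as `a → 0⁺`, i.e. `U a = a + o(a)`. -/
theorem stmt12 (lam : ℝ) (hlam : 1 < lam) :
    ∃ δ > (0:ℝ), ∃ U : ℝ → ℝ,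
      (∀ a ∈ Set.Ioo (0:ℝ) δ,
        U a ∈ Set.Ioo (0:ℝ) 1 ∧
        (U a) ^ lam - U a + a = 0 ∧
        (∀ v : ℝ, 0 < v → v ^ lam - v + a = 0 → U a ≤ v) ∧
        a < U a) ∧
      Filter.Tendsto (fun a => U a / a) (nhdsWithin 0 (Set.Ioi (0:ℝ))) (nhds 1) := by
  have hlim : Tendsto (fun a : ℝ => (2 * a) ^ (lam - 1)) (𝓝 0) (𝓝 0) := by
    have hc : Continuous fun a : ℝ => (2 * a) ^ (lam - 1) :=
      (continuous_const.mul continuous_id).rpow_const fun _ => Or.inr (by linarith)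
    simpa [zero_rpow (sub_pos.2 hlam).ne'] using hc.tendsto 0
  obtain ⟨ε, hε, hsmall⟩ := Metric.eventually_nhds_iff.1
    (hlim.eventually_le_const (by norm_num : (0 : ℝ) < 1 / 2))
  have hex : ∀ a : ℝ, ∃ u : ℝ, a ∈ Ioo 0 (min ε (1 / 2)) →
      u ≤ 2 * a ∧ IsLeast {v : ℝ | 0 ≤ v ∧ v ^ lam - v + a = 0} u := by
    intro a
    by_cases ha : a ∈ Ioo 0 (min ε (1 / 2))
    · obtain ⟨u, hu⟩ := exists_isLeast_root hlam ha.1 (hsmall (by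
        rw [dist_zero_right, norm_of_nonneg ha.1.le]
        exact ha.2.trans_le (min_le_left _ _)))
      exact ⟨u, fun _ => hu⟩
    · exact ⟨0, fun h => absurd h ha⟩
  choose U hU using hex
  have hδ : 0 < min ε (1 / 2) := by positivity
  have hlt : ∀ a ∈ Ioo 0 (min ε (1 / 2)), a < U a := by
    intro a ha
    obtain ⟨-, ⟨hnonneg, hroot⟩, -⟩ := hU a ha
    have hle : a ≤ U a := by linarith [rpow_nonneg hnonneg lam]
    linarith [rpow_pos_of_pos (ha.1.trans_le hle) lam]
  refine ⟨min ε (1 / 2), hδ, U, fun a ha => ?_, ?_⟩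
  · obtain ⟨hle, ⟨-, hroot⟩, hmin⟩ := hU a ha
    have ha2 : a < 1 / 2 := ha.2.trans_le (min_le_right _ _)
    exact ⟨⟨ha.1.trans (hlt a ha), by linarith⟩, hroot, fun v hv hv0 => hmin ⟨hv.le, hv0⟩,
      hlt a ha⟩
  · have hupper : Tendsto (fun a : ℝ => 1 + 2 * (2 * a) ^ (lam - 1)) (𝓝[>] 0) (𝓝 1) := by
      simpa using ((hlim.const_mul 2).const_add 1).mono_left nhdsWithin_le_nhds
    refine tendsto_of_tendsto_of_tendsto_of_le_of_le' tendsto_const_nhds hupper ?_ ?_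
    · filter_upwards [Ioo_mem_nhdsGT hδ] with a ha
      exact (one_le_div ha.1).2 (hlt a ha).le
    · filter_upwards [Ioo_mem_nhdsGT hδ] with a ha
      obtain ⟨hle, ⟨-, hroot⟩, -⟩ := hU a ha
      exact root_div_le hlam ha.1 (ha.1.trans (hlt a ha)) hle hroot
end

section
/- Let λ > 1 and define A(u) = λ log(1/u) / (1 + λ - λ u - u^λ) for u ∈ (0,1). Then for every exponent p > 0, lim_{u → 0⁺} u^{p} A(u) = 0, while for p = 0, lim_{u → 0⁺} A(u) = +∞. In particular, the normalized phase sensitivity α_x(φ) = β_x(φ)/V tends to 0 as u → 0⁺ for each fixed φ ∈ [0,2) with φ ≠ 1 (where β_x(φ) = u^{λ(1-φ)} on [0,1) and u^{φ-1} on [1,2)), and tends to +∞ at φ = 1. -/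
open Real Set Filter Topology

theorem tendsto_one_add_sub_mul_sub_rpow {lam : ℝ} (hlam : 0 < lam) :
    Tendsto (fun u : ℝ => 1 + lam - lam * u - u ^ lam) (𝓝[>] 0) (𝓝 (1 + lam)) := by
  have h : ContinuousAt (fun u : ℝ => 1 + lam - lam * u - u ^ lam) 0 :=
    ((continuousAt_const.sub (continuousAt_const.mul continuousAt_id)).sub
      (Real.continuousAt_rpow_const 0 lam (Or.inr hlam.le)))
  simpa [Real.zero_rpow hlam.ne'] using h.tendsto.mono_left nhdsWithin_le_nhds

theorem tendsto_rpow_mul_log_div_zero {lam p : ℝ} (hlam : 0 < lam) (hp : 0 < p) :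
    Tendsto (fun u : ℝ => u ^ p * (lam * Real.log (1 / u) / (1 + lam - lam * u - u ^ lam)))
      (𝓝[>] 0) (𝓝 0) := by
  have h := ((tendsto_log_mul_rpow_nhdsGT_zero hp).const_mul (-lam)).div
    (tendsto_one_add_sub_mul_sub_rpow hlam) (by positivity)
  rw [mul_zero, zero_div] at h
  refine h.congr fun u => ?_
  simp only [one_div, Real.log_inv, Pi.div_apply]
  ring

theorem tendsto_log_div_atTop {lam : ℝ} (hlam : 0 < lam) :
    Tendsto (fun u : ℝ => lam * Real.log (1 / u) / (1 + lam - lam * u - u ^ lam))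
      (𝓝[>] 0) atTop := by
  have h : Tendsto (fun u : ℝ => lam * Real.log (1 / u)) (𝓝[>] 0) atTop := by
    simp only [one_div, Real.log_inv]
    exact (tendsto_neg_atBot_atTop.comp Real.tendsto_log_nhdsGT_zero).const_mul_atTop hlam
  simpa only [div_eq_mul_inv] using h.atTop_mul_pos (by positivity)
    ((tendsto_one_add_sub_mul_sub_rpow hlam).inv₀ (by positivity : 1 + lam ≠ 0))

/-- For `lam > 1` and `A u = lam log(1/u)/(1 + lam - lam u - u^lam)`: for every `p > 0`,
`u^p A u → 0` as `u → 0⁺`, while `A u → +∞`. In particular the normalized horizontal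
phase sensitivity `α_x(φ) = β_x(φ) A u` (with `β_x(φ) = u^{lam(1-φ)}` on `[0,1)` and
`u^{φ-1}` on `[1,2)`) tends to `0` for each fixed `φ ∈ [0,2)`, `φ ≠ 1`, and to `+∞`
at `φ = 1`. -/
theorem stmt14 (lam : ℝ) (hlam : 1 < lam)
    (A : ℝ → ℝ)
    (hA : A = fun u => lam * Real.log (1 / u) / (1 + lam - lam * u - u ^ lam)) :
    (∀ p : ℝ, 0 < p →
      Filter.Tendsto (fun u : ℝ => u ^ p * A u)
        (nhdsWithin 0 (Set.Ioi (0:ℝ))) (nhds 0)) ∧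
    Filter.Tendsto A (nhdsWithin 0 (Set.Ioi (0:ℝ))) Filter.atTop ∧
    (∀ φ : ℝ, φ ∈ Set.Ico (0:ℝ) 2 → φ ≠ 1 →
      Filter.Tendsto
        (fun u : ℝ => (if φ < 1 then u ^ (lam * (1 - φ)) else u ^ (φ - 1)) * A u)
        (nhdsWithin 0 (Set.Ioi (0:ℝ))) (nhds 0)) ∧
    Filter.Tendsto
      (fun u : ℝ => (if (1:ℝ) < 1 then u ^ (lam * (1 - 1)) else u ^ ((1:ℝ) - 1)) * A u)
      (nhdsWithin 0 (Set.Ioi (0:ℝ))) Filter.atTop := by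
  have hpos : 0 < lam := one_pos.trans hlam
  subst hA
  refine ⟨fun p hp => tendsto_rpow_mul_log_div_zero hpos hp, tendsto_log_div_atTop hpos,
    fun φ _ hne => ?_, ?_⟩
  · split_ifs with h
    · exact tendsto_rpow_mul_log_div_zero hpos (mul_pos hpos (sub_pos.2 h))
    · exact tendsto_rpow_mul_log_div_zero hpos
        (sub_pos.2 (lt_of_le_of_ne (not_lt.1 h) hne.symm))
  · simpa using tendsto_log_div_atTop hpos
end

section
/- Let λ > 1 and fix φ ∈ [0,1). Then lim_{u → 0⁺} u^{φ} / ( log(1/u) · (u - λ u^λ) ) = +∞. That is, in the heteroclinic limit the infinitesimal phase response to perturbations parallel to the unstable eigenvector direction diverges at every phase within a square. -/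
open Real Set Filter Topology

/-- In the heteroclinic limit `u → 0⁺` of the iris system with `lam > 1`, the
infinitesimal phase response to perturbations parallel to the unstable eigenvector,
`Z_u(φ) = u^φ / (log(1/u)(u - lam u^lam))`, diverges to `+∞` at every fixed phase
`φ ∈ [0,1)`. -/
theorem stmt16 (lam φ : ℝ) (hlam : 1 < lam) (hφ : φ ∈ Set.Ico (0:ℝ) 1) :
    Filter.Tendsto
      (fun u : ℝ => u ^ φ / (Real.log (1 / u) * (u - lam * u ^ lam)))
      (nhdsWithin 0 (Set.Ioi (0:ℝ))) Filter.atTop := by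
  have hfactor : Tendsto (fun u : ℝ => 1 - lam * u ^ (lam - 1)) (𝓝[>] 0) (𝓝 1) := by
    have h : Tendsto (fun u : ℝ => u ^ (lam - 1)) (𝓝[>] 0) (𝓝 0) := by
      have hc := (Real.continuousAt_rpow_const 0 (lam - 1) (Or.inr (by linarith))).tendsto
      rw [Real.zero_rpow (by linarith)] at hc
      exact hc.mono_left nhdsWithin_le_nhds
    simpa using (h.const_mul lam).const_sub 1
  have hlog : Tendsto (fun u : ℝ => -(Real.log u * u ^ (1 - φ))) (𝓝[>] 0) (𝓝 0) := by
    simpa using (tendsto_log_mul_rpow_nhdsGT_zero (sub_pos.mpr hφ.2)).neg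
  have hprod : Tendsto (fun u : ℝ => -(Real.log u * u ^ (1 - φ)) * (1 - lam * u ^ (lam - 1)))
      (𝓝[>] 0) (𝓝[>] 0) := by
    refine tendsto_nhdsWithin_iff.mpr ⟨by simpa using hlog.mul hfactor, ?_⟩
    filter_upwards [hfactor.eventually_const_lt one_pos,
      Ioo_mem_nhdsGT (zero_lt_one' ℝ)] with u hu hu01
    have hneg := Real.log_neg hu01.1 hu01.2
    have hpow := Real.rpow_pos_of_pos hu01.1 (1 - φ)
    exact mul_pos (neg_pos.mpr (mul_neg_of_neg_of_pos hneg hpow)) hu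
  refine hprod.inv_tendsto_nhdsGT_zero.congr' ?_
  filter_upwards [self_mem_nhdsWithin] with u (hu : 0 < u)
  have hpow := (Real.rpow_pos_of_pos hu φ).ne'
  rw [Pi.inv_apply, one_div, Real.log_inv, Real.rpow_sub hu, Real.rpow_sub hu, Real.rpow_one]
  field_simp
end

section
/- Let λ > 1 and fix φ ∈ [0,1). If φ ∈ [0, 1 - 1/λ], then lim_{u → 0⁺} u^{λ(1-φ)} / ( log(1/u) · (u - λ u^λ) ) = 0; if φ ∈ (1 - 1/λ, 1), then lim_{u → 0⁺} u^{λ(1-φ)} / ( log(1/u) · (u - λ u^λ) ) = +∞. Thus in the heteroclinic limit the phase response to perturbations parallel to the stable eigenvector direction converges to zero for phases at or before the critical phase φ* = 1 - 1/λ and diverges for phases after it. -/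
open Real Set Filter Topology

/-- Factoring `u` out of the denominator `u - lam * u ^ lam`. -/
lemma phase_response_factor (lam a : ℝ) {u : ℝ} (hu : 0 < u) :
    u ^ a / (Real.log (1 / u) * (u - lam * u ^ lam)) =
      u ^ (a - 1) * (Real.log u⁻¹)⁻¹ * (1 - lam * u ^ (lam - 1))⁻¹ := by
  have h₁ : u ^ a = u ^ (a - 1) * u := by
    rw [Real.rpow_sub_one hu.ne', div_mul_cancel₀ _ hu.ne']
  have h₂ : u - lam * u ^ lam = u * (1 - lam * u ^ (lam - 1)) := by
    rw [Real.rpow_sub_one hu.ne']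
    field_simp
  rw [h₁, h₂, one_div, mul_left_comm, mul_comm (u ^ (a - 1)), mul_div_mul_left _ _ hu.ne',
    div_eq_mul_inv, mul_inv, mul_assoc]

lemma tendsto_rpow_nhdsGT_zero_of_nonneg {p : ℝ} (hp : 0 ≤ p) :
    Tendsto (fun u : ℝ => u ^ p) (𝓝[>] 0) (𝓝 (0 ^ p)) :=
  (Real.continuousAt_rpow_const 0 p (Or.inr hp)).tendsto.mono_left nhdsWithin_le_nhds

lemma tendsto_inv_one_sub_mul_rpow {lam : ℝ} (hlam : 1 < lam) :
    Tendsto (fun u : ℝ => (1 - lam * u ^ (lam - 1))⁻¹) (𝓝[>] 0) (𝓝 1) := by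
  have h := tendsto_rpow_nhdsGT_zero_of_nonneg (sub_nonneg.2 hlam.le)
  rw [Real.zero_rpow (sub_pos.2 hlam).ne'] at h
  simpa using ((h.const_mul lam).const_sub 1).inv₀ (by simp)

/-- For exponent `a ≥ 1`, the phase response tends to `0` in the heteroclinic limit. -/
lemma tendsto_phase_response_zero {lam a : ℝ} (hlam : 1 < lam) (ha : 1 ≤ a) :
    Tendsto (fun u : ℝ => u ^ a / (Real.log (1 / u) * (u - lam * u ^ lam))) (𝓝[>] 0) (𝓝 0) := by
  have hlog : Tendsto (fun u : ℝ => (Real.log u⁻¹)⁻¹) (𝓝[>] 0) (𝓝 0) :=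
    tendsto_inv_atTop_zero.comp (Real.tendsto_log_atTop.comp tendsto_inv_nhdsGT_zero)
  have h := ((tendsto_rpow_nhdsGT_zero_of_nonneg (sub_nonneg.2 ha)).mul hlog).mul
    (tendsto_inv_one_sub_mul_rpow hlam)
  rw [mul_zero, zero_mul] at h
  refine h.congr' ?_
  filter_upwards [self_mem_nhdsWithin] with u hu
  exact (phase_response_factor lam a hu).symm

/-- For exponent `a < 1`, the phase response diverges to `+∞` in the heteroclinic limit. -/
lemma tendsto_phase_response_atTop {lam a : ℝ} (hlam : 1 < lam) (ha : a < 1) :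
    Tendsto (fun u : ℝ => u ^ a / (Real.log (1 / u) * (u - lam * u ^ lam))) (𝓝[>] 0) atTop := by
  have hlog : Tendsto (fun u : ℝ => -(Real.log u * u ^ (1 - a))) (𝓝[>] 0) (𝓝[>] 0) := by
    refine tendsto_nhdsWithin_iff.2 ⟨?_, ?_⟩
    · simpa using (tendsto_log_mul_rpow_nhdsGT_zero (sub_pos.2 ha)).neg
    · filter_upwards [Ioo_mem_nhdsGT (zero_lt_one' ℝ)] with u hu
      exact neg_pos.2 (mul_neg_of_neg_of_pos (Real.log_neg hu.1 hu.2) (Real.rpow_pos_of_pos hu.1 _))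
  have h := (tendsto_inv_nhdsGT_zero.comp hlog).atTop_mul_pos one_pos
    (tendsto_inv_one_sub_mul_rpow hlam)
  refine h.congr' ?_
  filter_upwards [self_mem_nhdsWithin] with u hu
  rw [phase_response_factor lam a hu, Function.comp_apply, ← neg_mul, ← Real.log_inv, mul_inv,
    ← Real.rpow_neg (le_of_lt hu), neg_sub, mul_comm (u ^ (a - 1))]

/-- In the heteroclinic limit `u → 0⁺` of the iris system with `lam > 1`, the
infinitesimal phase response to perturbations parallel to the stable eigenvector,
`Z_s(φ) = u^{lam(1-φ)} / (log(1/u)(u - lam u^lam))`, converges to `0` for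
`φ ∈ [0, 1 - 1/lam]` and diverges to `+∞` for `φ ∈ (1 - 1/lam, 1)`. -/
theorem stmt17 (lam φ : ℝ) (hlam : 1 < lam) (hφ : φ ∈ Set.Ico (0:ℝ) 1) :
    (φ ∈ Set.Icc (0:ℝ) (1 - 1 / lam) →
      Filter.Tendsto
        (fun u : ℝ => u ^ (lam * (1 - φ)) / (Real.log (1 / u) * (u - lam * u ^ lam)))
        (nhdsWithin 0 (Set.Ioi (0:ℝ))) (nhds 0)) ∧
    (φ ∈ Set.Ioo (1 - 1 / lam) 1 →
      Filter.Tendsto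
        (fun u : ℝ => u ^ (lam * (1 - φ)) / (Real.log (1 / u) * (u - lam * u ^ lam)))
        (nhdsWithin 0 (Set.Ioi (0:ℝ))) Filter.atTop) := by
  have hpos : 0 < lam := one_pos.trans hlam
  refine ⟨fun h => tendsto_phase_response_zero hlam ?_,
    fun h => tendsto_phase_response_atTop hlam ?_⟩
  · have := mul_le_mul_of_nonneg_left (le_sub_comm.1 h.2) hpos.le
    rwa [mul_one_div_cancel hpos.ne'] at this
  · have := mul_lt_mul_of_pos_left (sub_lt_comm.1 h.1) hpos
    rwa [mul_one_div_cancel hpos.ne'] at this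
end
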